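/- arXiv:2312.02361 — 2 statements merged into one kernel-verified Lean document; each statement's English description precedes it below -/
import Mathlib

section
/- Let ω denote the first infinite ordinal, and equip the class of ordinals with the order topology; for an ordinal α, regard the interval [0, α] = {β : β ≤ α} as a topological space with the subspace topology. If m and n are natural numbers with m > n, then there is no topological embedding of the space [0, ω^m] into the space [0, ω^n]. -/
open Ordinal in
theorem exists_dvd_between_of_mul_omega0_dvd {a x u : Ordinal} (hx : x ≠ 0) (h : a * ω ∣ x)
    (hu : u < x) : ∃ y, u < y ∧ y < x ∧ a ∣ y := by
  obtain ⟨q, rfl⟩ := h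
  have hq : 0 < q := pos_iff_ne_zero.2 (right_ne_zero_of_mul hx)
  have ha : 0 < a := pos_iff_ne_zero.2 (left_ne_zero_of_mul (left_ne_zero_of_mul hx))
  rw [mul_assoc] at hu ⊢
  obtain ⟨c, hc, huc⟩ :=
    (lt_mul_iff_of_isSuccLimit (isSuccLimit_mul_left isSuccLimit_omega0 hq)).1 hu
  exact ⟨a * c, huc, (mul_lt_mul_iff_right₀ ha).2 hc, dvd_mul_right _ _⟩

open Ordinal in
theorem mul_omega0_dvd_of_forall_exists_dvd_between {a z : Ordinal} (ha : a ≠ 0)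
    (h : ∀ w < z, ∃ y, w < y ∧ y < z ∧ a ∣ y) : a * ω ∣ z := by
  have ha' : 0 < a := pos_iff_ne_zero.2 ha
  have hz : z = a * (z / a) := by
    refine ((mul_div_le z a).eq_of_not_lt fun hlt => ?_).symm
    obtain ⟨_, hwy, hyz, c, rfl⟩ := h _ hlt
    exact ((mul_lt_mul_iff_right₀ ha').1 hwy).not_ge ((mul_le_iff_le_div ha).1 hyz.le)
  generalize z / a = q at hz
  subst hz
  refine mul_dvd_mul_left a (isSuccPrelimit_iff_omega0_dvd.1 fun b hb => ?_)
  obtain ⟨_, hwy, hyz, c, rfl⟩ := h _ ((mul_lt_mul_iff_right₀ ha').2 hb.lt)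
  exact hb.2 ((mul_lt_mul_iff_right₀ ha').1 hwy) ((mul_lt_mul_iff_right₀ ha').1 hyz)

open Ordinal Topology in
theorem opow_dvd_apply_of_continuous_injective {a : Ordinal} {g : Set.Iic a → Ordinal}
    (hg : Continuous g) (hinj : Function.Injective g) (k : ℕ) (x : Set.Iic a) (hx : x.1 ≠ 0)
    (hk : ω ^ k ∣ x.1) : ω ^ k ∣ g x ∧ (k ≠ 0 → g x ≠ 0) := by
  induction k generalizing x with
  | zero => simp
  | succ k ih =>
    have key : ∀ V ∈ 𝓝 (g x), ∃ y ∈ V, y < g x ∧ ω ^ k ∣ y := by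
      intro V hV
      have hV' : g ⁻¹' (V ∩ Set.Iio (Order.succ (g x))) ∈ 𝓝 x :=
        hg.continuousAt.preimage_mem_nhds
          (Filter.inter_mem hV (Iio_mem_nhds (Order.lt_succ _)))
      obtain ⟨t, ht, hts⟩ := mem_nhds_subtype _ _ _ |>.1 hV'
      obtain ⟨u, hu, hut⟩ := exists_Ioc_subset_of_mem_nhds ht ⟨0, pos_iff_ne_zero.2 hx⟩
      obtain ⟨y, huy, hyx, hy⟩ := exists_dvd_between_of_mul_omega0_dvd hx (pow_succ ω k ▸ hk) hu
      let y' : Set.Iic a := ⟨y, hyx.le.trans x.2⟩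
      have hmem : g y' ∈ V ∩ Set.Iio (Order.succ (g x)) := @hts y' (hut ⟨huy, hyx.le⟩)
      have hne : g y' ≠ g x := fun h => hyx.ne (congrArg Subtype.val (hinj h))
      exact ⟨g y', hmem.1, (Order.lt_succ_iff.1 hmem.2).lt_of_ne hne,
        (ih y' (ne_bot_of_gt huy) hy).1⟩
    constructor
    · rw [pow_succ]
      refine mul_omega0_dvd_of_forall_exists_dvd_between (pow_ne_zero _ omega0_ne_zero)
        fun w hw => ?_
      exact key _ (Ioi_mem_nhds hw)
    · intro _ h0
      obtain ⟨y, -, hy, -⟩ := key _ Filter.univ_mem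
      exact not_lt_bot (h0 ▸ hy)

open Ordinal in
/-- If `m > n`, then there is no topological embedding of the ordinal space
`[0, ω^m] = ω^m + 1` into `[0, ω^n] = ω^n + 1` (with the order/subspace topology). -/
theorem no_embedding_omega_pow {m n : ℕ} (hmn : m > n) :
    ¬ ∃ f : Set.Iic ((omega0 : Ordinal) ^ (m : Ordinal)) →
        Set.Iic ((omega0 : Ordinal) ^ (n : Ordinal)),
      Topology.IsEmbedding f := by
  rintro ⟨f, hf⟩
  have hm : (ω : Ordinal) ^ (m : Ordinal) ≠ 0 := (opow_pos _ omega0_pos).ne'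
  obtain ⟨hdvd, hne⟩ := opow_dvd_apply_of_continuous_injective
    (continuous_subtype_val.comp hf.continuous) (Subtype.val_injective.comp hf.injective) m
    ⟨_, Set.self_mem_Iic⟩ hm (by simp)
  have hle := (Ordinal.le_of_dvd (hne (by lia)) hdvd).trans (f _).2
  rw [← opow_natCast, opow_le_opow_iff_right one_lt_omega0, Nat.cast_le] at hle
  lia
end

section
/- Let ω denote the first infinite ordinal, and equip the class of ordinals with the order topology; for an ordinal α, regard the interval [0, α] = {β : β ≤ α} as a topological space with the subspace topology. If m and n are natural numbers with m ≠ n, then the spaces [0, ω^m] and [0, ω^n] are not homeomorphic. -/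
open Filter Set Topology in
theorem Topology.IsOpenEmbedding.derivedSet_preimage {X Y : Type*} [TopologicalSpace X]
    [TopologicalSpace Y] {f : X → Y} (hf : IsOpenEmbedding f) (s : Set Y) :
    derivedSet (f ⁻¹' s) = f ⁻¹' derivedSet s := by
  ext x
  rw [mem_preimage, mem_derivedSet, mem_derivedSet, ← comap_principal, hf.accPt_comap_iff]

open Set Topology in
theorem Topology.IsOpenEmbedding.iterate_derivedSet_univ {X Y : Type*} [TopologicalSpace X]
    [TopologicalSpace Y] {f : X → Y} (hf : IsOpenEmbedding f) (k : ℕ) :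
    derivedSet^[k] univ = f ⁻¹' derivedSet^[k] univ := by
  induction k with
  | zero => simp
  | succ k ih =>
    rw [Function.iterate_succ_apply', Function.iterate_succ_apply', ih, hf.derivedSet_preimage]

namespace Ordinal

theorem isSuccLimit_of_mul_right_dense {a q : Ordinal} (hq : a * q ≠ 0)
    (h : ∀ p < a * q, ∃ c, p < a * c ∧ a * c < a * q) : Order.IsSuccLimit q := by
  have ha : 0 < a := pos_iff_ne_zero.2 (left_ne_zero_of_mul hq)
  rcases zero_or_succ_or_isSuccLimit q with rfl | ⟨b, rfl⟩ | hl
  · simp at hq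
  · obtain ⟨c, hc, hc'⟩ := h (a * b) ((mul_lt_mul_iff_right₀ ha).2 (Order.lt_succ b))
    rw [mul_lt_mul_iff_right₀ ha] at hc hc'
    exact absurd (Order.lt_succ_iff.1 hc') hc.not_ge
  · exact hl

theorem dvd_of_multiples_dense {a b : Ordinal} (ha : a ≠ 0)
    (h : ∀ p < b, ∃ c, p < a * c ∧ a * c < b) : a ∣ b := by
  rw [dvd_iff_mod_eq_zero]
  by_contra hr
  have hlt : a * (b / a) < b := by
    conv_rhs => rw [← div_add_mod b a]
    exact lt_add_of_pos_right _ (pos_iff_ne_zero.2 hr)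
  obtain ⟨c, hc, hc'⟩ := h _ hlt
  exact ((mul_le_iff_le_div ha).1 hc'.le).not_gt ((mul_lt_mul_iff_right₀ (pos_iff_ne_zero.2 ha)).1 hc)

theorem multiples_dense_iff {a b : Ordinal} (ha : a ≠ 0) (hb : b ≠ 0) :
    (∀ p < b, ∃ c, p < a * c ∧ a * c < b) ↔ a * ω ∣ b := by
  constructor
  · intro h
    obtain ⟨q, rfl⟩ := dvd_of_multiples_dense ha h
    exact mul_dvd_mul_left a
      (isSuccPrelimit_iff_omega0_dvd.1 (isSuccLimit_of_mul_right_dense hb h).isSuccPrelimit)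
  · rintro ⟨q, rfl⟩ p hp
    have hl : Order.IsSuccLimit (ω * q) :=
      isSuccLimit_mul_left isSuccLimit_omega0 (pos_iff_ne_zero.2 (right_ne_zero_of_mul hb))
    rw [mul_assoc] at hp ⊢
    obtain ⟨c, hc, hpc⟩ := (lt_mul_iff_of_isSuccLimit hl).1 hp
    exact ⟨c, hpc, (mul_lt_mul_iff_right₀ (pos_iff_ne_zero.2 ha)).2 hc⟩

theorem iterate_derivedSet_univ (k : ℕ) :
    derivedSet^[k] (Set.univ : Set Ordinal) = {x | ω ^ k ∣ x ∧ (k ≠ 0 → x ≠ 0)} := by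
  induction k with
  | zero => simp
  | succ k ih =>
    ext b
    rw [Function.iterate_succ_apply', ih, mem_derivedSet, SuccOrder.accPt_principal]
    have hk : (ω : Ordinal) ^ k ≠ 0 := pow_ne_zero k omega0_ne_zero
    simp only [isMin_iff_eq_bot, bot_eq_zero, Set.mem_ofPred_eq, pow_succ, ne_eq,
      Nat.add_eq_zero_iff, one_ne_zero, and_false, not_false_eq_true, forall_const]
    rw [and_comm]
    refine and_congr_left fun hb => ?_
    rw [← multiples_dense_iff hk hb]
    refine forall₂_congr fun p hp => ⟨?_, ?_⟩
    · rintro ⟨_, ⟨⟨c, rfl⟩, -⟩, hc⟩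
      exact ⟨c, hc⟩
    · rintro ⟨c, hc⟩
      exact ⟨_, ⟨⟨c, rfl⟩, fun _ => (bot_le.trans_lt hc.1).ne'⟩, hc⟩

theorem isOpenEmbedding_subtypeVal_Iic (a : Ordinal) :
    Topology.IsOpenEmbedding (Subtype.val : Set.Iic a → Ordinal) := by
  refine IsOpen.isOpenEmbedding_subtypeVal ?_
  rw [← Order.Iio_succ]
  exact isOpen_Iio

theorem iterate_derivedSet_univ_Iic_nonempty_iff {m k : ℕ} :
    (derivedSet^[k] (Set.univ : Set (Set.Iic (ω ^ (m : Ordinal))))).Nonempty ↔ k ≤ m := by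
  rw [(isOpenEmbedding_subtypeVal_Iic _).iterate_derivedSet_univ, iterate_derivedSet_univ]
  constructor
  · rintro ⟨⟨x, hx⟩, hdvd, hx0⟩
    rcases eq_or_ne k 0 with rfl | hk
    · exact m.zero_le
    · have h := (le_of_dvd (hx0 hk) hdvd).trans hx
      rw [← opow_natCast, opow_le_opow_iff_right one_lt_omega0] at h
      exact_mod_cast h
  · intro h
    refine ⟨⟨ω ^ (m : Ordinal), Set.self_mem_Iic⟩, ?_, fun _ => opow_ne_zero _ omega0_ne_zero⟩
    rw [← opow_natCast]
    exact opow_dvd_opow _ (by exact_mod_cast h)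

end Ordinal

open Ordinal in
/-- If `m ≠ n`, then the ordinal spaces `[0, ω^m] = ω^m + 1` and `[0, ω^n] = ω^n + 1`
(with the order/subspace topology) are not homeomorphic. -/
theorem not_homeomorphic_omega_pow {m n : ℕ} (hmn : m ≠ n) :
    ¬ Nonempty
      (Set.Iic ((omega0 : Ordinal) ^ (m : Ordinal)) ≃ₜ
        Set.Iic ((omega0 : Ordinal) ^ (n : Ordinal))) := by
  rintro ⟨f⟩
  have h (k : ℕ) : k ≤ m ↔ k ≤ n := by
    rw [← iterate_derivedSet_univ_Iic_nonempty_iff, ← iterate_derivedSet_univ_Iic_nonempty_iff,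
      f.isOpenEmbedding.iterate_derivedSet_univ, f.surjective.nonempty_preimage]
  exact hmn (le_antisymm ((h m).1 le_rfl) ((h n).2 le_rfl))
end
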